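/- arXiv:2004.12931 — 2 statements merged into one kernel-verified Lean document; each statement's English description precedes it below -/
import Mathlib

section
/- Suppose α° ∈ ℝ^d is a critical point of λ, λ(α°) is a simple eigenvalue of T(α°), and its unit eigenvector f° is non-vanishing on crossing edges. If the Hermitian d×d matrix W is negative semidefinite, then λ(α) ≤ λ(α°) for all α ∈ ℝ^d, i.e. λ attains its global maximum at α°. -/
noncomputable section

open Matrix Complex
open scoped ComplexOrder

/-- Eigenvalues of a square complex matrix, sorted in increasing order
(junk value `0` if the matrix is not Hermitian). -/
noncomputable def sortedEigs {n : ℕ} (A : Matrix (Fin n) (Fin n) ℂ) : Fin n → ℝ :=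
  if hA : A.IsHermitian then hA.eigenvalues ∘ Tuple.sort hA.eigenvalues else 0

/-- The Moore–Penrose pseudoinverse of a Hermitian matrix (junk value `0` otherwise). -/
noncomputable def pinvH {m : Type*} [Fintype m] [DecidableEq m] (A : Matrix m m ℂ) :
    Matrix m m ℂ :=
  if hA : A.IsHermitian then
    (hA.eigenvectorUnitary : Matrix m m ℂ) *
      Matrix.diagonal (fun i => if hA.eigenvalues i = 0 then 0 else ((hA.eigenvalues i : ℂ))⁻¹) *
      star (hA.eigenvectorUnitary : Matrix m m ℂ)
  else 0

/-- The orthogonal projection onto the null space of a Hermitian matrix. -/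
noncomputable def nullProj {m : Type*} [Fintype m] [DecidableEq m] (A : Matrix m m ℂ) :
    Matrix m m ℂ :=
  1 - pinvH A * A

/-- The number of positive eigenvalues (with multiplicity) of a Hermitian matrix. -/
noncomputable def iPos {m : Type*} [Fintype m] [DecidableEq m] (A : Matrix m m ℂ) : ℕ :=
  if hA : A.IsHermitian then Nat.card {i // 0 < hA.eigenvalues i} else 0

/-- The number of negative eigenvalues (with multiplicity) of a Hermitian matrix. -/
noncomputable def iNeg {m : Type*} [Fintype m] [DecidableEq m] (A : Matrix m m ℂ) : ℕ :=
  if hA : A.IsHermitian then Nat.card {i // hA.eigenvalues i < 0} else 0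

/-- The number of zero eigenvalues (with multiplicity) of a Hermitian matrix. -/
noncomputable def iZero {m : Type*} [Fintype m] [DecidableEq m] (A : Matrix m m ℂ) : ℕ :=
  if hA : A.IsHermitian then Nat.card {i // hA.eigenvalues i = 0} else 0

/-- The sorted eigenvalues of a Hermitian matrix diagonalize it, are increasing, and come with a
unitary matrix of eigenvectors. -/
theorem exists_unitary_diag_sortedEigs {N : ℕ} {A : Matrix (Fin N) (Fin N) ℂ}
    (hA : A.IsHermitian) :
    Monotone (sortedEigs A) ∧ ∃ U : Matrix (Fin N) (Fin N) ℂ, U * Uᴴ = 1 ∧ Uᴴ * U = 1 ∧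
      A = U * diagonal (fun i => (sortedEigs A i : ℂ)) * Uᴴ := by
  have hs : sortedEigs A = hA.eigenvalues ∘ Tuple.sort hA.eigenvalues := by
    simp [sortedEigs, hA]
  refine ⟨hs ▸ Tuple.monotone_sort _, ?_⟩
  set σ := Tuple.sort hA.eigenvalues
  set V : Matrix (Fin N) (Fin N) ℂ := hA.eigenvectorUnitary.1
  have hV1 : V * Vᴴ = 1 := Unitary.coe_mul_star_self hA.eigenvectorUnitary
  have hV2 : Vᴴ * V = 1 := Unitary.coe_star_mul_self hA.eigenvectorUnitary
  refine ⟨V.submatrix id σ, ?_, ?_, ?_⟩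
  · rw [conjTranspose_submatrix, submatrix_mul_equiv, hV1, submatrix_id_id]
  · rw [conjTranspose_submatrix, ← submatrix_mul _ _ _ _ _ Function.bijective_id, hV2,
      submatrix_one_equiv]
  · have hd : diagonal (fun i => (sortedEigs A i : ℂ))
        = (diagonal (fun i => (hA.eigenvalues i : ℂ))).submatrix σ σ := by
      rw [submatrix_diagonal_equiv, hs]; rfl
    rw [hd, conjTranspose_submatrix, submatrix_mul_equiv, submatrix_mul_equiv, submatrix_id_id]
    exact hA.spectral_theorem

/-- The quadratic form of a shifted diagonalized matrix. -/
theorem re_quadForm_sub_smul {m : Type*} [Fintype m] [DecidableEq m] {A U : Matrix m m ℂ}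
    {l : m → ℝ} (hU : U * Uᴴ = 1) (hA : A = U * diagonal (fun i => (l i : ℂ)) * Uᴴ)
    (c : ℝ) (x : m → ℂ) :
    (star x ⬝ᵥ (A - (c : ℂ) • (1 : Matrix m m ℂ)) *ᵥ x).re
      = ∑ i, (l i - c) * normSq ((Uᴴ *ᵥ x) i) := by
  have h1 : A - (c : ℂ) • (1 : Matrix m m ℂ)
      = U * diagonal (fun i => ((l i - c : ℝ) : ℂ)) * Uᴴ := by
    have h2 : diagonal (fun i => ((l i - c : ℝ) : ℂ))
        = diagonal (fun i => (l i : ℂ)) - (c : ℂ) • (1 : Matrix m m ℂ) := by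
      ext i j
      by_cases hij : i = j <;> simp [hij]
    rw [h2, Matrix.mul_sub, Matrix.sub_mul, ← hA]
    simp [hU]
  have h3 : star x ⬝ᵥ (A - (c : ℂ) • (1 : Matrix m m ℂ)) *ᵥ x
      = star (Uᴴ *ᵥ x) ⬝ᵥ diagonal (fun i => ((l i - c : ℝ) : ℂ)) *ᵥ (Uᴴ *ᵥ x) := by
    rw [h1, star_mulVec, conjTranspose_conjTranspose, ← dotProduct_mulVec, mulVec_mulVec,
      mulVec_mulVec]
  rw [h3, dotProduct, re_sum]
  refine Finset.sum_congr rfl fun i _ => ?_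
  rw [mulVec_diagonal]
  simp only [Pi.star_apply, RCLike.star_def, mul_re, mul_im, conj_re, conj_im, ofReal_re,
    ofReal_im, normSq_apply]
  ring

/-- Comparison of ordered eigenvalues: if the form of `C - c` is bounded by a (possibly
degenerate) congruence transform of the form of `A - c`, and the `n`-th eigenvalue of `A` is at
most `c`, then so is that of `C`. -/
theorem sortedEigs_le_of_quadForm_le {N : ℕ} {A C : Matrix (Fin N) (Fin N) ℂ}
    (hA : A.IsHermitian) (hC : C.IsHermitian) (K : Matrix (Fin N) (Fin N) ℂ) (n : Fin N) (c : ℝ)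
    (hn : sortedEigs A n ≤ c)
    (hle : ∀ x : Fin N → ℂ, (star x ⬝ᵥ (C - (c : ℂ) • (1 : Matrix _ _ ℂ)) *ᵥ x).re ≤
      (star (K *ᵥ x) ⬝ᵥ (A - (c : ℂ) • (1 : Matrix _ _ ℂ)) *ᵥ (K *ᵥ x)).re) :
    sortedEigs C n ≤ c := by
  by_contra! hlt
  obtain ⟨hmA, U, hU, -, hAd⟩ := exists_unitary_diag_sortedEigs hA
  obtain ⟨hmC, V, hV, -, hCd⟩ := exists_unitary_diag_sortedEigs hC
  let M : Matrix (Fin N) (Fin N) ℂ := fun i =>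
    if i < n then Vᴴ i else if n < i then (Uᴴ * K) i else 0
  have hdet : M.det = 0 := det_eq_zero_of_row_eq_zero n fun j => by simp [M]
  obtain ⟨x, hx0, hx⟩ := exists_mulVec_eq_zero_iff.mpr hdet
  have hx1 : ∀ i, i < n → (Vᴴ *ᵥ x) i = 0 := fun i hi => by
    have h1 := congrFun hx i
    simpa [mulVec, M, hi] using h1
  have hx2 : ∀ i, n < i → (Uᴴ *ᵥ (K *ᵥ x)) i = 0 := fun i hi => by
    have h1 := congrFun hx i
    rw [mulVec_mulVec]
    simpa [mulVec, M, hi, hi.le.not_gt] using h1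
  have hle' := hle x
  rw [re_quadForm_sub_smul hV hCd, re_quadForm_sub_smul hU hAd] at hle'
  have hR : ∑ i, (sortedEigs A i - c) * normSq ((Uᴴ *ᵥ (K *ᵥ x)) i) ≤ 0 := by
    refine Finset.sum_nonpos fun i _ => ?_
    rcases lt_or_ge n i with hi | hi
    · simp [hx2 i hi]
    · exact mul_nonpos_of_nonpos_of_nonneg (by linarith [hmA hi]) (normSq_nonneg _)
  have hL : ∀ i, 0 ≤ (sortedEigs C i - c) * normSq ((Vᴴ *ᵥ x) i) := fun i => by
    rcases lt_or_ge i n with hi | hi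
    · simp [hx1 i hi]
    · exact mul_nonneg (by linarith [hmC hi]) (normSq_nonneg _)
  have hz := (Finset.sum_eq_zero_iff_of_nonneg fun i _ => hL i).mp
    (le_antisymm (hle'.trans hR) (Finset.sum_nonneg fun i _ => hL i))
  have hVx : Vᴴ *ᵥ x = 0 := by
    ext i
    rcases lt_or_ge i n with hi | hi
    · exact hx1 i hi
    · have h1 := hz i (Finset.mem_univ i)
      have h2 : sortedEigs C i - c ≠ 0 :=
        (sub_pos.mpr (hlt.trans_le (hmC hi))).ne'
      simpa [h2] using h1
  apply hx0
  rw [← one_mulVec x, ← hV, ← mulVec_mulVec, hVx, mulVec_zero]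

theorem pinvH_isHermitian {m : Type*} [Fintype m] [DecidableEq m] {A : Matrix m m ℂ} :
    (pinvH A).IsHermitian := by
  unfold pinvH
  split_ifs with hA
  · rw [IsHermitian, conjTranspose_mul, conjTranspose_mul, diagonal_conjTranspose, Matrix.mul_assoc,
      star_eq_conjTranspose, conjTranspose_conjTranspose]
    congr 3
    ext i
    simp only [Pi.star_apply]
    split_ifs <;> simp
  · exact isHermitian_zero

theorem mul_pinvH_mul_self {m : Type*} [Fintype m] [DecidableEq m] {A : Matrix m m ℂ}
    (hA : A.IsHermitian) : A * pinvH A * A = A := by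
  rw [pinvH, dif_pos hA]
  set V : Matrix m m ℂ := hA.eigenvectorUnitary.1
  have hV : star V * V = 1 := Unitary.coe_star_mul_self hA.eigenvectorUnitary
  have hs : A = V * diagonal (fun i => (hA.eigenvalues i : ℂ)) * star V := hA.spectral_theorem
  set l := hA.eigenvalues
  clear_value l V
  set D' := diagonal (fun i => if l i = 0 then (0 : ℂ) else (l i : ℂ)⁻¹) with hD'
  have hD : diagonal (fun i => (l i : ℂ)) * D' * diagonal (fun i => (l i : ℂ))
      = diagonal (fun i => (l i : ℂ)) := by
    rw [hD', diagonal_mul_diagonal, diagonal_mul_diagonal]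
    congr 1
    ext i
    split_ifs with h <;> simp [h]
  set D := diagonal (fun i => (l i : ℂ))
  calc A * (V * D' * star V) * A
      = V * (D * ((star V * V) * D' * (star V * V)) * D) * star V := by
        rw [hs]; simp only [Matrix.mul_assoc]
    _ = A := by rw [hV, Matrix.one_mul, Matrix.mul_one, hD, hs]

/-- A matrix that annihilates a simple eigenvector on the left lies in the range of the shifted
Hermitian matrix. -/
theorem mul_pinvH_mul_of_simple {N d : ℕ} {A : Matrix (Fin N) (Fin N) ℂ} (hA : A.IsHermitian)
    (n : Fin N)
    (hsimple : Nat.card {i : Fin N // sortedEigs A i = sortedEigs A n} = 1)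
    {f : Fin N → ℂ} (hf : f ≠ 0) (heig : A *ᵥ f = (sortedEigs A n : ℂ) • f)
    {B : Matrix (Fin N) (Fin d) ℂ} (hB : Bᴴ *ᵥ f = 0) :
    (A - (sortedEigs A n : ℂ) • 1) * pinvH (A - (sortedEigs A n : ℂ) • 1) * B = B := by
  obtain ⟨-, U, hU, hU', hAd⟩ := exists_unitary_diag_sortedEigs hA
  have huniq : ∀ i, sortedEigs A i = sortedEigs A n → i = n := fun i hi => by
    obtain ⟨hs, -⟩ := Nat.card_eq_one_iff_unique.mp hsimple
    exact congrArg Subtype.val (hs.elim ⟨i, hi⟩ ⟨n, rfl⟩)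
  have hcoord : ∀ x : Fin N → ℂ, A *ᵥ x = (sortedEigs A n : ℂ) • x →
      x = (Uᴴ *ᵥ x) n • U.col n := fun x hx => by
    have h1 : diagonal (fun i => (sortedEigs A i : ℂ)) *ᵥ (Uᴴ *ᵥ x)
        = (sortedEigs A n : ℂ) • (Uᴴ *ᵥ x) := by
      rw [← mulVec_smul, ← hx]
      conv_rhs => rw [hAd]
      rw [mulVec_mulVec, mulVec_mulVec, ← Matrix.mul_assoc, ← Matrix.mul_assoc, hU',
        Matrix.one_mul]
    have h2 : Uᴴ *ᵥ x = Pi.single n ((Uᴴ *ᵥ x) n) := by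
      ext i
      by_cases hi : i = n
      · subst hi; simp
      · have h3 := congrFun h1 i
        rw [mulVec_diagonal, Pi.smul_apply, smul_eq_mul] at h3
        have h4 : (sortedEigs A i : ℂ) ≠ sortedEigs A n := fun h =>
          hi (huniq i (by exact_mod_cast h))
        rw [Pi.single_eq_of_ne hi]
        by_contra h5
        exact h4 (mul_right_cancel₀ h5 h3)
    conv_lhs => rw [← one_mulVec x, ← hU, ← mulVec_mulVec, h2, mulVec_single]
    ext i
    simp [mul_comm]
  have hcf : (Uᴴ *ᵥ f) n ≠ 0 := fun h => hf (by rw [hcoord f heig, h, zero_smul])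
  have hBu : Bᴴ *ᵥ U.col n = 0 := by
    rw [hcoord f heig, mulVec_smul] at hB
    exact (smul_eq_zero.mp hB).resolve_left hcf
  set S := A - (sortedEigs A n : ℂ) • (1 : Matrix (Fin N) (Fin N) ℂ) with hS
  have hSH : S.IsHermitian := by
    rw [hS, IsHermitian, conjTranspose_sub, hA.eq, conjTranspose_smul]
    simp
  have hker : ∀ x, S *ᵥ x = 0 → Bᴴ *ᵥ x = 0 := fun x hx => by
    rw [hS, sub_mulVec, smul_mulVec, one_mulVec, sub_eq_zero] at hx
    rw [hcoord x hx, mulVec_smul, hBu, smul_zero]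
  have h0 : S * (1 - pinvH S * S) = 0 := by
    rw [Matrix.mul_sub, Matrix.mul_one, ← Matrix.mul_assoc, mul_pinvH_mul_self hSH, sub_self]
  have h1 : Bᴴ * (1 - pinvH S * S) = 0 := by
    refine Matrix.ext_of_mulVec_single fun i => ?_
    rw [← mulVec_mulVec, zero_mulVec]
    apply hker
    rw [mulVec_mulVec, h0, zero_mulVec]
  have h2 := congrArg conjTranspose h1
  rw [conjTranspose_mul, conjTranspose_sub, conjTranspose_one, conjTranspose_mul, hSH.eq,
    pinvH_isHermitian.eq, conjTranspose_conjTranspose, conjTranspose_zero, Matrix.sub_mul,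
    Matrix.one_mul, sub_eq_zero] at h2
  exact h2.symm

/-- Completing the square: the Schur complement of the block matrix with blocks `S`, `B`, `Bᴴ`, `Ω`
governs the difference with a congruence transform of `S`. -/
theorem add_eq_congr_add_schur {m k : Type*} [Fintype m] [DecidableEq m] [Fintype k]
    {S P : Matrix m m ℂ} {B : Matrix m k ℂ} {Ω : Matrix k k ℂ}
    (hS : S.IsHermitian) (hP : P.IsHermitian) (hB : S * P * B = B) (Y : Matrix k m ℂ) :
    S + B * Y + Yᴴ * Bᴴ + Yᴴ * Ω * Y
      = (1 + P * B * Y)ᴴ * S * (1 + P * B * Y) + Yᴴ * (Ω - Bᴴ * P * B) * Y := by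
  have hB' : Bᴴ * P * S = Bᴴ := by
    have h1 := congrArg conjTranspose hB
    rwa [conjTranspose_mul, conjTranspose_mul, hS.eq, hP.eq, ← Matrix.mul_assoc] at h1
  have e1 : S * (P * B * Y) = B * Y := by
    rw [← Matrix.mul_assoc, ← Matrix.mul_assoc, hB]
  have e2 : (1 + P * B * Y)ᴴ = 1 + Yᴴ * (Bᴴ * P) := by
    simp [conjTranspose_mul, hP.eq, Matrix.mul_assoc]
  rw [e2, Matrix.mul_assoc (1 + _) S, Matrix.mul_add S, e1, Matrix.mul_one, Matrix.add_mul,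
    Matrix.one_mul, Matrix.mul_add, Matrix.mul_assoc _ (Bᴴ * P) S, hB', Matrix.mul_sub, Matrix.sub_mul]
  simp only [Matrix.mul_assoc]
  abel

/-- The change of a crossing-edge term under a phase `e` (inverse `e'`), completed to a square
through the endpoint `v` where the eigenvector does not vanish; `ku, kv, lu, lv` stand for
indicators of row and column indices, and `b, gu, gv` for the conjugates of `a, fu, fv`. -/
theorem crossing_edge_identity {i a b e e' fu fv gu gv ku kv lu lv : ℂ} (hi : i * i = -1)
    (he : e * e' = 1) (hfv : fv ≠ 0) (hgv : gv ≠ 0) (hc : a * fv * gu = b * gv * fu) :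
    ku * lv * (a * e) + kv * lu * (b * e') =
      ku * lv * a + kv * lu * b
      + i * (a * fv * ku - b * fu * kv) * (i * (1 - e) / fv * lv)
      + (-i * (1 - e') / gv * kv) * (-i * (b * gv * lu - a * gu * lv))
      + (-i * (1 - e') / gv * kv) * (-(a * fv * gu)) * (i * (1 - e) / fv * lv) := by
  grind

theorem crossing_term_isHermitian {N : ℕ} (p q : Fin N) (a : ℂ) (t : ℝ) :
    (Matrix.single p q (a * Complex.exp (Complex.I * (t : ℂ))) +
      Matrix.single q p ((starRingEnd ℂ) a * Complex.exp (-(Complex.I * (t : ℂ))))).IsHermitian := by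
  rw [IsHermitian, conjTranspose_add, conjTranspose_single, conjTranspose_single, add_comm]
  simp [← exp_conj]

/-- Theorem 1.3(2) of the paper: if the test matrix `W` is negative semidefinite at a
critical point with simple eigenvalue and eigenvector nonvanishing on crossing edges,
then the critical point is a global maximum of the band. -/
theorem global_max_of_W_negSemidef
    (d N : ℕ) (hd : 0 < d) (hN : 0 < N)
    (u v : Fin d → Fin N) (h : Fin d → ℂ) (hh : ∀ j, h j ≠ 0)
    (T0 : Matrix (Fin N) (Fin N) ℂ) (hT0 : T0.IsHermitian)
    (T : (Fin d → ℝ) → Matrix (Fin N) (Fin N) ℂ)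
    (hT : ∀ α : Fin d → ℝ, T α = T0 + ∑ j : Fin d,
      (Matrix.single (u j) (v j) (h j * Complex.exp (Complex.I * (α j : ℂ))) +
       Matrix.single (v j) (u j)
         ((starRingEnd ℂ) (h j) * Complex.exp (-(Complex.I * (α j : ℂ))))))
    (n : Fin N)
    (α0 : Fin d → ℝ) (f : Fin N → ℂ)
    (hsimple : Nat.card {i : Fin N // sortedEigs (T α0) i = sortedEigs (T α0) n} = 1)
    (hunit : star f ⬝ᵥ f = (1 : ℂ))
    (heig : (T α0).mulVec f = ((sortedEigs (T α0) n : ℝ) : ℂ) • f)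
    (hcrit : ∀ j, (h j * Complex.exp (Complex.I * (α0 j : ℂ)) * f (v j) *
      (starRingEnd ℂ) (f (u j))).im = 0)
    (hnv : ∀ j, f (u j) ≠ 0 ∨ f (v j) ≠ 0)
    (B : Matrix (Fin N) (Fin d) ℂ)
    (hB : B = Matrix.of fun i j => Complex.I *
      (h j * Complex.exp (Complex.I * (α0 j : ℂ)) * f (v j) * (if i = u j then 1 else 0) -
       (starRingEnd ℂ) (h j) * Complex.exp (-(Complex.I * (α0 j : ℂ))) * f (u j) *
         (if i = v j then 1 else 0)))
    (Ω : Matrix (Fin d) (Fin d) ℂ)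
    (hΩ : Ω = Matrix.diagonal fun j =>
      (((-(h j * Complex.exp (Complex.I * (α0 j : ℂ)) * f (v j) *
        (starRingEnd ℂ) (f (u j)))).re : ℝ) : ℂ))
    (W : Matrix (Fin d) (Fin d) ℂ)
    (hW : W = Ω - Bᴴ * pinvH (T α0 - ((sortedEigs (T α0) n : ℝ) : ℂ) •
      (1 : Matrix (Fin N) (Fin N) ℂ)) * B)
    (hWnsd : (-W).PosSemidef) :
    ∀ α : Fin d → ℝ, sortedEigs (T α) n ≤ sortedEigs (T α0) n := by
  intro α
  set c := sortedEigs (T α0) n with hc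
  have hTH : ∀ β, (T β).IsHermitian := fun β => by
    rw [hT]
    exact hT0.add (isSelfAdjoint_sum _ fun j _ => crossing_term_isHermitian _ _ _ _)
  have hexp : ∀ t : ℝ, (starRingEnd ℂ) (exp (I * (t : ℂ))) = exp (-(I * (t : ℂ))) := fun t => by
    rw [← exp_conj]; simp
  have hreal : ∀ j, (h j * exp (I * (α0 j : ℂ))) * f (v j) * (starRingEnd ℂ) (f (u j)) =
      ((starRingEnd ℂ) (h j) * exp (-(I * (α0 j : ℂ)))) * (starRingEnd ℂ) (f (v j)) * f (u j) :=
    fun j => by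
      have h1 := conj_eq_iff_im.mpr (hcrit j)
      rw [← h1]
      simp only [map_mul, hexp, conj_conj]
  have hf : f ≠ 0 := by
    rintro rfl
    simp at hunit
  have hBf : Bᴴ *ᵥ f = 0 := by
    ext j
    have hsum : (Bᴴ *ᵥ f) j = -I * (((starRingEnd ℂ) (h j) * exp (-(I * (α0 j : ℂ)))) *
        (starRingEnd ℂ) (f (v j)) * f (u j) -
        (h j * exp (I * (α0 j : ℂ))) * f (v j) * (starRingEnd ℂ) (f (u j))) := by
      have hexp' : (starRingEnd ℂ) (exp (-(I * (α0 j : ℂ)))) = exp (I * (α0 j : ℂ)) := by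
        rw [← hexp, conj_conj]
      simp only [mulVec, dotProduct, conjTranspose_apply, hB, of_apply, RCLike.star_def, map_mul,
        map_sub, hexp, hexp', conj_conj, conj_I, apply_ite (starRingEnd ℂ), map_zero,
        mul_sub, sub_mul, Finset.sum_sub_distrib, mul_ite, ite_mul, mul_one, mul_zero, zero_mul,
        Finset.sum_ite_eq', Finset.mem_univ, if_true]
      ring
    rw [hsum, hreal j, sub_self, mul_zero, Pi.zero_apply]
  have hSPB := mul_pinvH_mul_of_simple (hTH α0) n hsimple hf heig hBf
  rw [← hc] at hSPB
  set S := T α0 - (c : ℂ) • (1 : Matrix (Fin N) (Fin N) ℂ) with hS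
  have hSH : S.IsHermitian := by
    rw [hS, IsHermitian, conjTranspose_sub, (hTH α0).eq, conjTranspose_smul]
    simp
  let e : Fin d → ℂ := fun j => exp (I * ((α j - α0 j : ℝ) : ℂ))
  let Y : Matrix (Fin d) (Fin N) ℂ := fun j k =>
    if f (v j) ≠ 0 then I * (1 - e j) / f (v j) * (if k = v j then 1 else 0)
    else -I * (1 - (starRingEnd ℂ) (e j)) / f (u j) * (if k = u j then 1 else 0)
  have hkey : T α - (c : ℂ) • (1 : Matrix (Fin N) (Fin N) ℂ)
      = S + B * Y + Yᴴ * Bᴴ + Yᴴ * Ω * Y := by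
    rw [hS, hT α, hT α0, hΩ]
    ext k l
    simp only [Matrix.add_apply, Matrix.sub_apply, Matrix.sum_apply]
    rw [Matrix.mul_apply, Matrix.mul_apply, Matrix.mul_apply]
    simp only [mul_diagonal, conjTranspose_apply]
    rw [add_sub_right_comm, add_sub_right_comm, add_assoc, add_assoc, add_assoc,
      ← Finset.sum_add_distrib, ← Finset.sum_add_distrib, ← Finset.sum_add_distrib]
    congr 1
    refine Finset.sum_congr rfl fun j _ => ?_
    have hee : e j * (starRingEnd ℂ) (e j) = 1 := by
      simp only [e]
      rw [hexp, ← exp_add, add_neg_cancel, exp_zero]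
    have ha : h j * exp (I * (α j : ℂ)) = h j * exp (I * (α0 j : ℂ)) * e j := by
      rw [mul_assoc, ← exp_add]
      congr 2
      push_cast
      ring
    have hb : (starRingEnd ℂ) (h j) * exp (-(I * (α j : ℂ))) =
        (starRingEnd ℂ) (h j) * exp (-(I * (α0 j : ℂ))) * (starRingEnd ℂ) (e j) := by
      simpa only [map_mul, hexp] using congrArg (starRingEnd ℂ) ha
    have hab : (starRingEnd ℂ) (h j * exp (I * (α0 j : ℂ)))
        = (starRingEnd ℂ) (h j) * exp (-(I * (α0 j : ℂ))) := by rw [map_mul, hexp]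
    have hω : (((-(h j * exp (I * (α0 j : ℂ)) * f (v j) *
        (starRingEnd ℂ) (f (u j)))).re : ℝ) : ℂ) =
        -(h j * exp (I * (α0 j : ℂ)) * f (v j) * (starRingEnd ℂ) (f (u j))) :=
      conj_eq_iff_re.mp (by rw [map_neg, conj_eq_iff_im.mpr (hcrit j)])
    have hsingle : ∀ (p q : Fin N) (z : ℂ), Matrix.single p q z k l =
        (if k = p then 1 else 0) * (if l = q then 1 else 0) * z := fun p q z => by
      rw [Matrix.single_apply]
      by_cases h1 : k = p <;> by_cases h2 : l = q <;> simp [h1, h2, eq_comm]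
    have hr := hreal j
    have hI : I * I = -1 := I_mul_I
    rw [hω, ha, hb]
    simp only [hsingle, hB, of_apply]
    rw [← hab] at hr ⊢
    generalize h j * exp (I * (α0 j : ℂ)) = a at *
    by_cases hv0 : f (v j) ≠ 0
    · have hv1 : (starRingEnd ℂ) (f (v j)) ≠ 0 := by simpa using hv0
      have := crossing_edge_identity (ku := if k = u j then 1 else 0)
        (kv := if k = v j then 1 else 0) (lu := if l = u j then 1 else 0)
        (lv := if l = v j then 1 else 0) hI hee hv0 hv1 hr
      simp only [Y, if_pos hv0, RCLike.star_def, map_mul, map_sub, map_div₀, conj_I, conj_conj,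
        apply_ite (starRingEnd ℂ), map_one, map_zero]
      linear_combination this
    · have hu0 : f (u j) ≠ 0 := (hnv j).resolve_right hv0
      have hu1 : (starRingEnd ℂ) (f (u j)) ≠ 0 := by simpa using hu0
      have hI' : -I * -I = -1 := by rw [neg_mul_neg, hI]
      have := crossing_edge_identity (ku := if k = v j then 1 else 0)
        (kv := if k = u j then 1 else 0) (lu := if l = v j then 1 else 0)
        (lv := if l = u j then 1 else 0) (a := (starRingEnd ℂ) a) (b := a)
        (fu := f (v j)) (gu := (starRingEnd ℂ) (f (v j))) hI' (by rw [mul_comm]; exact hee) hu0 hu1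
        (by linear_combination -hr)
      simp only [Y, if_neg hv0, RCLike.star_def, map_mul, map_sub, map_div₀, map_neg, conj_I,
        conj_conj, apply_ite (starRingEnd ℂ), map_one, map_zero]
      rw [hr]
      linear_combination this
  rw [add_eq_congr_add_schur hSH pinvH_isHermitian hSPB, ← hW] at hkey
  refine sortedEigs_le_of_quadForm_le (hTH α0) (hTH α) (1 + pinvH S * B * Y) n c hc.ge fun x => ?_
  have hneg : 0 ≤ (star (Y *ᵥ x) ⬝ᵥ (-W) *ᵥ (Y *ᵥ x)).re :=
    (Complex.le_def.mp (hWnsd.dotProduct_mulVec_nonneg (Y *ᵥ x))).1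
  rw [neg_mulVec, dotProduct_neg, neg_re] at hneg
  have hform : ∀ {m : ℕ} (K : Matrix (Fin m) (Fin N) ℂ) (M : Matrix (Fin m) (Fin m) ℂ),
      star x ⬝ᵥ (Kᴴ * M * K) *ᵥ x = star (K *ᵥ x) ⬝ᵥ M *ᵥ (K *ᵥ x) := fun K M => by
    rw [star_mulVec, ← dotProduct_mulVec, mulVec_mulVec, mulVec_mulVec, Matrix.mul_assoc]
  rw [hkey, add_mulVec, dotProduct_add, hform, hform, add_re]
  linarith
end
end

section
/- Suppose α° is a critical point of λ, λ(α°) is a simple eigenvalue of T(α°), and its unit eigenvector f° is non-vanishing on crossing edges. Then for every α ∈ ℝ^d, the eigenvalues of T(α) and of S satisfy λ_{n − i_−(Ω) − i_∞(S)}(S) ≤ λ_n(T(α)) − λ(α°) ≤ λ_{n + i_+(Ω)}(S), with the convention that λ_k(S) = −∞ for k < 1 and λ_k(S) = +∞ for k > dim 𝒬. -/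
noncomputable section

open Matrix Complex
open scoped ComplexOrder

lemma sortedEigs_monotone {n : ℕ} (A : Matrix (Fin n) (Fin n) ℂ) : Monotone (sortedEigs A) := by
  unfold sortedEigs
  split_ifs with hA
  · exact Tuple.monotone_sort _
  · exact monotone_const

/-- The quadratic form of a Hermitian matrix in coordinates of a sorted orthonormal eigenbasis. -/
lemma exists_eigencoordinates {n : ℕ} {A : Matrix (Fin n) (Fin n) ℂ} (hA : A.IsHermitian) :
    ∃ φ : Fin n → ((Fin n → ℂ) →ₗ[ℂ] ℂ),
      (∀ x, (star x ⬝ᵥ A *ᵥ x).re = ∑ i, sortedEigs A i * normSq (φ i x)) ∧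
      (∀ x, (star x ⬝ᵥ x).re = ∑ i, normSq (φ i x)) := by
  set U : Matrix (Fin n) (Fin n) ℂ := (hA.eigenvectorUnitary : Matrix (Fin n) (Fin n) ℂ)
  have hUU : U * Uᴴ = 1 := by
    have := (Matrix.mem_unitaryGroup_iff (A := U)).1 hA.eigenvectorUnitary.2
    simpa [star_eq_conjTranspose] using this
  have hspec : A = U * diagonal (fun i => (hA.eigenvalues i : ℂ)) * Uᴴ := by
    have := hA.spectral_theorem
    rw [Unitary.conjStarAlgAut_apply] at this
    simpa [star_eq_conjTranspose, Function.comp_def] using this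
  let σ := Tuple.sort hA.eigenvalues
  refine ⟨fun i => (LinearMap.proj (σ i)).comp (Uᴴ).mulVecLin, fun x => ?_, fun x => ?_⟩
  · have h1 : star x ⬝ᵥ A *ᵥ x =
        star (Uᴴ *ᵥ x) ⬝ᵥ (diagonal (fun i => (hA.eigenvalues i : ℂ)) *ᵥ (Uᴴ *ᵥ x)) := by
      rw [star_mulVec, conjTranspose_conjTranspose, ← dotProduct_mulVec, mulVec_mulVec,
        mulVec_mulVec, ← hspec]
    rw [h1]
    simp only [dotProduct, mulVec_diagonal, Complex.re_sum, LinearMap.comp_apply,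
      LinearMap.proj_apply, mulVecLin_apply, sortedEigs, dif_pos hA, Function.comp_apply]
    rw [← Equiv.sum_comp σ]
    refine Finset.sum_congr rfl fun i _ => ?_
    simp [normSq_apply]
    ring
  · have h1 : star x ⬝ᵥ x = star (Uᴴ *ᵥ x) ⬝ᵥ (Uᴴ *ᵥ x) := by
      rw [star_mulVec, conjTranspose_conjTranspose, ← dotProduct_mulVec, mulVec_mulVec, hUU,
        one_mulVec]
    rw [h1]
    simp only [dotProduct, Complex.re_sum, LinearMap.comp_apply,
      LinearMap.proj_apply, mulVecLin_apply]
    rw [← Equiv.sum_comp σ]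
    refine Finset.sum_congr rfl fun i _ => ?_
    simp [normSq_apply]

lemma re_star_dotProduct_self_pos {m : ℕ} {y : Fin m → ℂ} (hy : y ≠ 0) :
    0 < (star y ⬝ᵥ y).re :=
  (Complex.pos_iff.1 (Matrix.dotProduct_star_self_pos_iff.2 hy)).1

lemma exists_ne_zero_forall_eq_zero {m : ℕ} {ι : Type*} [Fintype ι]
    (φ : ι → ((Fin m → ℂ) →ₗ[ℂ] ℂ)) (hcard : Fintype.card ι < m) :
    ∃ y, y ≠ 0 ∧ ∀ i, φ i y = 0 := by
  have hker : LinearMap.ker (LinearMap.pi φ) ≠ ⊥ :=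
    LinearMap.ker_ne_bot_of_finrank_lt (by simpa using hcard)
  obtain ⟨y, hy, hy0⟩ := Submodule.exists_mem_ne_zero_of_ne_bot hker
  exact ⟨y, hy0, fun i => congrFun (LinearMap.mem_ker.1 hy) i⟩

section Bracketing

variable {N m : ℕ} {A : Matrix (Fin N) (Fin N) ℂ} {S : Matrix (Fin m) (Fin m) ℂ}
  {V : Matrix (Fin N) (Fin m) ℂ} {ι : Type*} [Fintype ι]

/-- An upper bound for the quadratic form of `A` on a compression, valid on the common kernel of
finitely many functionals, bounds the eigenvalues of `A` by shifted ones of `S`. -/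
lemma sortedEigs_le_of_compression (hA : A.IsHermitian) (hS : S.IsHermitian) (hV : Vᴴ * V = 1)
    (c : ι → ((Fin m → ℂ) →ₗ[ℂ] ℂ)) (μ : ℝ)
    (hform : ∀ y, (∀ j, c j y = 0) → (star (V *ᵥ y) ⬝ᵥ A *ᵥ (V *ᵥ y)).re ≤
      (star y ⬝ᵥ S *ᵥ y).re + μ * (star y ⬝ᵥ y).re)
    (n : Fin N) (k : Fin m) (hk : (n : ℕ) + Fintype.card ι ≤ k) :
    sortedEigs A n ≤ sortedEigs S k + μ := by
  obtain ⟨φ, hφ, hφ'⟩ := exists_eigencoordinates hA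
  obtain ⟨ψ, hψ, hψ'⟩ := exists_eigencoordinates hS
  obtain ⟨y, hy0, hy⟩ := exists_ne_zero_forall_eq_zero
    (Sum.elim (Sum.elim c fun i : Finset.Ioi k => ψ i)
      fun i : Finset.Iio n => (φ i).comp V.mulVecLin) (by
        have := k.2
        simp only [Fintype.card_sum, Fintype.card_coe, Fin.card_Ioi, Fin.card_Iio]
        omega)
  have hc := fun j => hy (.inl (.inl j))
  have hSk := fun i => hy (.inl (.inr i))
  have hAn := fun i => hy (.inr i)
  simp only [Sum.elim_inl, Sum.elim_inr, LinearMap.comp_apply, mulVecLin_apply] at hc hSk hAn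
  have hnorm : star (V *ᵥ y) ⬝ᵥ (V *ᵥ y) = star y ⬝ᵥ y := by
    rw [star_mulVec, ← dotProduct_mulVec, mulVec_mulVec, hV, one_mulVec]
  have h1 : sortedEigs A n * (star y ⬝ᵥ y).re ≤ (star (V *ᵥ y) ⬝ᵥ A *ᵥ (V *ᵥ y)).re := by
    rw [← hnorm, hφ, hφ', Finset.mul_sum]
    refine Finset.sum_le_sum fun i _ => ?_
    rcases lt_or_ge i n with hi | hi
    · simp [hAn ⟨i, Finset.mem_Iio.2 hi⟩]
    · exact mul_le_mul_of_nonneg_right (sortedEigs_monotone A hi) (normSq_nonneg _)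
  have h2 : (star y ⬝ᵥ S *ᵥ y).re ≤ sortedEigs S k * (star y ⬝ᵥ y).re := by
    rw [hψ, hψ', Finset.mul_sum]
    refine Finset.sum_le_sum fun i _ => ?_
    rcases lt_or_ge k i with hi | hi
    · simp [hSk ⟨i, Finset.mem_Ioi.2 hi⟩]
    · exact mul_le_mul_of_nonneg_right (sortedEigs_monotone S hi) (normSq_nonneg _)
  refine le_of_mul_le_mul_right ?_ (re_star_dotProduct_self_pos hy0)
  linarith [hform y hc]

/-- A lower bound for the quadratic form of `A` on a compression, valid on the common kernel of
finitely many functionals, bounds the eigenvalues of `A` by shifted ones of `S`. -/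
lemma le_sortedEigs_of_compression (hA : A.IsHermitian) (hS : S.IsHermitian) (hV : Vᴴ * V = 1)
    (c : ι → ((Fin m → ℂ) →ₗ[ℂ] ℂ)) (μ : ℝ)
    (hform : ∀ y, (∀ j, c j y = 0) → (star y ⬝ᵥ S *ᵥ y).re + μ * (star y ⬝ᵥ y).re ≤
      (star (V *ᵥ y) ⬝ᵥ A *ᵥ (V *ᵥ y)).re)
    (n : Fin N) (k : Fin m) (hk : (k : ℕ) + Fintype.card ι + N ≤ n + m) :
    sortedEigs S k + μ ≤ sortedEigs A n := by
  obtain ⟨φ, hφ, hφ'⟩ := exists_eigencoordinates hA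
  obtain ⟨ψ, hψ, hψ'⟩ := exists_eigencoordinates hS
  obtain ⟨y, hy0, hy⟩ := exists_ne_zero_forall_eq_zero
    (Sum.elim (Sum.elim c fun i : Finset.Iio k => ψ i)
      fun i : Finset.Ioi n => (φ i).comp V.mulVecLin) (by
        have := n.2
        simp only [Fintype.card_sum, Fintype.card_coe, Fin.card_Ioi, Fin.card_Iio]
        omega)
  have hc := fun j => hy (.inl (.inl j))
  have hSk := fun i => hy (.inl (.inr i))
  have hAn := fun i => hy (.inr i)
  simp only [Sum.elim_inl, Sum.elim_inr, LinearMap.comp_apply, mulVecLin_apply] at hc hSk hAn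
  have hnorm : star (V *ᵥ y) ⬝ᵥ (V *ᵥ y) = star y ⬝ᵥ y := by
    rw [star_mulVec, ← dotProduct_mulVec, mulVec_mulVec, hV, one_mulVec]
  have h1 : (star (V *ᵥ y) ⬝ᵥ A *ᵥ (V *ᵥ y)).re ≤ sortedEigs A n * (star y ⬝ᵥ y).re := by
    rw [← hnorm, hφ, hφ', Finset.mul_sum]
    refine Finset.sum_le_sum fun i _ => ?_
    rcases lt_or_ge n i with hi | hi
    · simp [hAn ⟨i, Finset.mem_Ioi.2 hi⟩]
    · exact mul_le_mul_of_nonneg_right (sortedEigs_monotone A hi) (normSq_nonneg _)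
  have h2 : sortedEigs S k * (star y ⬝ᵥ y).re ≤ (star y ⬝ᵥ S *ᵥ y).re := by
    rw [hψ, hψ', Finset.mul_sum]
    refine Finset.sum_le_sum fun i _ => ?_
    rcases lt_or_ge i k with hi | hi
    · simp [hSk ⟨i, Finset.mem_Iio.2 hi⟩]
    · exact mul_le_mul_of_nonneg_right (sortedEigs_monotone S hi) (normSq_nonneg _)
  refine le_of_mul_le_mul_right ?_ (re_star_dotProduct_self_pos hy0)
  linarith [hform y hc]

end Bracketing

section Diagonal

variable {ι : Type*} [DecidableEq ι] (w : ι → ℝ)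

lemma isHermitian_diagonal_ofReal : (diagonal fun j => (w j : ℂ)).IsHermitian :=
  isHermitian_diagonal_of_self_adjoint _ (by ext; simp)

variable [Fintype ι]

lemma pinvH_diagonal :
    pinvH (diagonal fun j => (w j : ℂ)) = diagonal fun j => ((w j)⁻¹ : ℂ) := by
  have hA := isHermitian_diagonal_ofReal w
  rw [pinvH, dif_pos hA]
  set U : Matrix ι ι ℂ := (hA.eigenvectorUnitary : Matrix ι ι ℂ)
  have hUU : U * star U = 1 := (Matrix.mem_unitaryGroup_iff (A := U)).1 hA.eigenvectorUnitary.2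
  have hUU' : star U * U = 1 := (Matrix.mem_unitaryGroup_iff' (A := U)).1 hA.eigenvectorUnitary.2
  have hspec : diagonal (fun j => (w j : ℂ)) * U =
      U * diagonal (fun i => (hA.eigenvalues i : ℂ)) := by
    have := hA.spectral_theorem
    rw [Unitary.conjStarAlgAut_apply] at this
    conv_lhs => rw [this]
    rw [Matrix.mul_assoc, hUU', Matrix.mul_one]
    rfl
  have hinv : U * diagonal (fun i => if hA.eigenvalues i = 0 then 0
      else ((hA.eigenvalues i : ℂ))⁻¹) = diagonal (fun j => ((w j)⁻¹ : ℂ)) * U := by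
    ext i j
    have hij := congrFun (congrFun hspec i) j
    rw [diagonal_mul, mul_diagonal] at hij ⊢
    by_cases h0 : U i j = 0
    · simp [h0]
    · have hw : (w i : ℂ) = hA.eigenvalues j := by
        rw [mul_comm] at hij
        exact mul_left_cancel₀ h0 hij
      rw [hw, mul_comm]
      congr 1
      split_ifs with he <;> simp [he]
  rw [hinv, Matrix.mul_assoc, hUU, Matrix.mul_one]

lemma nullProj_diagonal :
    nullProj (diagonal fun j => (w j : ℂ)) = diagonal fun j => if w j = 0 then 1 else 0 := by
  rw [nullProj, pinvH_diagonal, diagonal_mul_diagonal, ← diagonal_one, diagonal_sub]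
  congr 1
  ext j
  split_ifs with hj <;> simp [hj]

lemma map_eigenvalues_diagonal :
    Finset.univ.val.map (isHermitian_diagonal_ofReal w).eigenvalues = Finset.univ.val.map w := by
  have h1 := (isHermitian_diagonal_ofReal w).roots_charpoly_eq_eigenvalues
  have h2 : (diagonal fun j => (w j : ℂ)).charpoly.roots =
      Finset.univ.val.map fun j => (w j : ℂ) := by
    rw [charpoly_diagonal]
    simpa [Multiset.map_map, Function.comp_def] using
      Polynomial.roots_multiset_prod_X_sub_C (Finset.univ.val.map fun j => (w j : ℂ))
  rw [h2] at h1
  refine Multiset.map_injective Complex.ofReal_injective ?_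
  rw [Multiset.map_map, Multiset.map_map]
  exact h1.symm

lemma card_eigenvalues_diagonal (p : ℝ → Prop) [DecidablePred p] :
    Nat.card {i // p ((isHermitian_diagonal_ofReal w).eigenvalues i)} =
      Fintype.card {j // p (w j)} := by
  have h := congrArg (Multiset.countP p) (map_eigenvalues_diagonal w)
  rw [Multiset.countP_map, Multiset.countP_map] at h
  rw [Nat.card_eq_fintype_card, Fintype.card_subtype, Fintype.card_subtype]
  exact h

lemma iPos_diagonal : iPos (diagonal fun j => (w j : ℂ)) = Fintype.card {j // 0 < w j} := by
  rw [iPos, dif_pos (isHermitian_diagonal_ofReal w), card_eigenvalues_diagonal w (0 < ·)]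

lemma iNeg_diagonal : iNeg (diagonal fun j => (w j : ℂ)) = Fintype.card {j // w j < 0} := by
  rw [iNeg, dif_pos (isHermitian_diagonal_ofReal w), card_eigenvalues_diagonal w (· < 0)]

lemma re_star_dotProduct_mul_diagonal_mul {N : ℕ} (B : Matrix (Fin N) ι ℂ) (x : Fin N → ℂ) :
    (star x ⬝ᵥ (B * (diagonal fun j => (w j : ℂ)) * Bᴴ) *ᵥ x).re =
      ∑ j, w j * normSq ((Bᴴ *ᵥ x) j) := by
  have h1 : star x ⬝ᵥ (B * (diagonal fun j => (w j : ℂ)) * Bᴴ) *ᵥ x =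
      star (Bᴴ *ᵥ x) ⬝ᵥ ((diagonal fun j => (w j : ℂ)) *ᵥ (Bᴴ *ᵥ x)) := by
    rw [star_mulVec, conjTranspose_conjTranspose, ← dotProduct_mulVec, mulVec_mulVec,
      mulVec_mulVec]
  rw [h1]
  simp only [dotProduct, mulVec_diagonal, Complex.re_sum]
  refine Finset.sum_congr rfl fun i _ => ?_
  simp [normSq_apply]
  ring

end Diagonal

open scoped ComplexConjugate in
/-- Changing the phase of an edge weight changes its quadratic form by a difference of two
rank-one forms. -/
lemma edge_form_difference (a a' p q x y : ℂ) (ha : normSq a' = normSq a)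
    (him : (a * q * conj p).im = 0) :
    normSq (conj (a * q) * x - a' * conj p * y) - normSq (conj (a * q) * x - a * conj p * y) =
      -(a * q * conj p).re * (2 * (a' * y * conj x).re - 2 * (a * y * conj x).re) := by
  have hr : a * q * conj p = ((a * q * conj p).re : ℂ) := by
    apply Complex.ext <;> simp [him]
  have key : ∀ b : ℂ, normSq (conj (a * q) * x - b * conj p * y) =
      normSq a * normSq q * normSq x + normSq b * normSq p * normSq y -
        2 * ((a * q * conj p).re * (b * y * conj x).re) := by
    intro b
    rw [normSq_sub]
    have : conj (a * q) * x * conj (b * conj p * y) =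
        conj (a * q * conj p * (b * y * conj x)) := by
      simp only [map_mul, conj_conj]; ring
    rw [this, conj_re, hr, re_ofReal_mul, ofReal_re]
    simp only [normSq_mul, normSq_conj]
  rw [key, key, ha]
  ring

open scoped ComplexConjugate in
lemma re_star_dotProduct_edge {N : ℕ} (u v : Fin N) (a : ℂ) (x : Fin N → ℂ) :
    (star x ⬝ᵥ (single u v a + single v u (conj a)) *ᵥ x).re = 2 * (a * x v * conj (x u)).re := by
  have h : star x ⬝ᵥ (single u v a + single v u (conj a)) *ᵥ x =
      a * x v * conj (x u) + conj (a * x v * conj (x u)) := by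
    rw [add_mulVec, dotProduct_add, single_mulVec, single_mulVec]
    change star x ⬝ᵥ Pi.single u _ + star x ⬝ᵥ Pi.single v _ = _
    simp only [dotProduct_single, Pi.star_apply, RCLike.star_def, map_mul, conj_conj]
    ring
  rw [h, add_re, conj_re]
  ring

open scoped ComplexConjugate in
lemma conj_mul_exp_I (z : ℂ) (t : ℝ) :
    conj z * exp (-(I * (t : ℂ))) = conj (z * exp (I * (t : ℂ))) := by
  rw [map_mul, ← exp_conj, map_mul, conj_I, conj_ofReal, neg_mul]

/-- Lemma 3.8 of the paper (combined Weyl/Cauchy bracketing): at a critical point with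
simple eigenvalue and eigenvector non-vanishing on crossing edges, for every `α`,
`λ_{n − i_−(Ω) − i_∞(S)}(S) ≤ λ_n(T(α)) − λ(α°) ≤ λ_{n + i_+(Ω)}(S)`, where `S` is the
compression of `T(α°) − λ(α°) − BΩ⁺B*` to `𝒬 = Null(BPB*)` (realized via an orthonormal
basis `V` of `𝒬`), with the convention `λ_k(S) = −∞` for `k < 1` and `+∞` for `k > dim 𝒬`
(encoded by the extended eigenvalue function `eS : ℤ → EReal`). -/
theorem combined_Weyl_bracketing
    (d N : ℕ) (hd : 0 < d) (hN : 0 < N)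
    (u v : Fin d → Fin N) (h : Fin d → ℂ) (hh : ∀ j, h j ≠ 0)
    (T0 : Matrix (Fin N) (Fin N) ℂ) (hT0 : T0.IsHermitian)
    (T : (Fin d → ℝ) → Matrix (Fin N) (Fin N) ℂ)
    (hT : ∀ α : Fin d → ℝ, T α = T0 + ∑ j : Fin d,
      (Matrix.single (u j) (v j) (h j * Complex.exp (Complex.I * (α j : ℂ))) +
       Matrix.single (v j) (u j)
         ((starRingEnd ℂ) (h j) * Complex.exp (-(Complex.I * (α j : ℂ))))))
    (n : Fin N)
    (α0 : Fin d → ℝ) (f : Fin N → ℂ)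
    (hsimple : Nat.card {i : Fin N // sortedEigs (T α0) i = sortedEigs (T α0) n} = 1)
    (hunit : star f ⬝ᵥ f = (1 : ℂ))
    (heig : (T α0).mulVec f = ((sortedEigs (T α0) n : ℝ) : ℂ) • f)
    (hcrit : ∀ j, (h j * Complex.exp (Complex.I * (α0 j : ℂ)) * f (v j) *
      (starRingEnd ℂ) (f (u j))).im = 0)
    (hnv : ∀ j, f (u j) ≠ 0 ∨ f (v j) ≠ 0)
    (B : Matrix (Fin N) (Fin d) ℂ)
    (hB : B = Matrix.of fun i j => Complex.I *
      (h j * Complex.exp (Complex.I * (α0 j : ℂ)) * f (v j) * (if i = u j then 1 else 0) -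
       (starRingEnd ℂ) (h j) * Complex.exp (-(Complex.I * (α0 j : ℂ))) * f (u j) *
         (if i = v j then 1 else 0)))
    (Ω : Matrix (Fin d) (Fin d) ℂ)
    (hΩ : Ω = Matrix.diagonal fun j =>
      (((-(h j * Complex.exp (Complex.I * (α0 j : ℂ)) * f (v j) *
        (starRingEnd ℂ) (f (u j)))).re : ℝ) : ℂ))
    (P : Matrix (Fin d) (Fin d) ℂ) (hP : P = nullProj Ω)
    (m : ℕ)
    (V : Matrix (Fin N) (Fin m) ℂ) (hV : Vᴴ * V = 1)
    (hVrange : LinearMap.range V.mulVecLin = LinearMap.ker (B * P * Bᴴ).mulVecLin)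
    (S : Matrix (Fin m) (Fin m) ℂ)
    (hS : S = Vᴴ * (T α0 - ((sortedEigs (T α0) n : ℝ) : ℂ) •
      (1 : Matrix (Fin N) (Fin N) ℂ) - B * pinvH Ω * Bᴴ) * V)
    (iinf : ℕ) (hiinf : iinf = (B * P * Bᴴ).rank)
    (eS : ℤ → EReal)
    (heS : ∀ k : ℤ, eS k =
      if hk : 1 ≤ k ∧ k ≤ (m : ℤ) then
        ((sortedEigs S ⟨(k - 1).toNat, by omega⟩ : ℝ) : EReal)
      else if k < 1 then ⊥ else ⊤) :
    ∀ α : Fin d → ℝ,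
      eS ((n : ℤ) + 1 - (iNeg Ω : ℤ) - (iinf : ℤ)) ≤
        ((sortedEigs (T α) n - sortedEigs (T α0) n : ℝ) : EReal) ∧
      ((sortedEigs (T α) n - sortedEigs (T α0) n : ℝ) : EReal) ≤
        eS ((n : ℤ) + 1 + (iPos Ω : ℤ)) := by
  intro α
  set lam := sortedEigs (T α0) n
  let a : (Fin d → ℝ) → Fin d → ℂ := fun β j => h j * Complex.exp (Complex.I * (β j : ℂ))
  let w : Fin d → ℝ := fun j => -(a α0 j * f (v j) * (starRingEnd ℂ) (f (u j))).re
  have hT' : ∀ β, T β = T0 + ∑ j, (Matrix.single (u j) (v j) (a β j) +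
      Matrix.single (v j) (u j) ((starRingEnd ℂ) (a β j))) := fun β => by
    simp only [hT, conj_mul_exp_I, a]
  have hΩ' : Ω = Matrix.diagonal fun j => (w j : ℂ) := by
    rw [hΩ]; rfl
  have hnormSq : ∀ β j, normSq (a β j) = normSq (h j) := fun β j => by
    simp [a, normSq_eq_norm_sq, mul_comm Complex.I]
  have hTherm : ∀ β, (T β).IsHermitian := fun β => by
    rw [hT']
    refine hT0.add ?_
    rw [IsHermitian, conjTranspose_sum]
    refine Finset.sum_congr rfl fun j _ => ?_
    simp [conjTranspose_add, conjTranspose_single, add_comm]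
  have hquad : ∀ β (x : Fin N → ℂ), (star x ⬝ᵥ T β *ᵥ x).re = (star x ⬝ᵥ T0 *ᵥ x).re +
      ∑ j, 2 * (a β j * x (v j) * (starRingEnd ℂ) (x (u j))).re := fun β x => by
    rw [hT', add_mulVec, dotProduct_add, add_re, sum_mulVec, dotProduct_sum, Complex.re_sum]
    simp only [re_star_dotProduct_edge]
  have hBx : ∀ (x : Fin N → ℂ) j, (Bᴴ *ᵥ x) j = -Complex.I *
      ((starRingEnd ℂ) (a α0 j * f (v j)) * x (u j) -
        a α0 j * (starRingEnd ℂ) (f (u j)) * x (v j)) := fun x j => by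
    have hcol : ∀ i, (starRingEnd ℂ) (B i j) * x i = -Complex.I *
        ((starRingEnd ℂ) (a α0 j * f (v j)) * (if i = u j then x i else 0) -
          a α0 j * (starRingEnd ℂ) (f (u j)) * (if i = v j then x i else 0)) := fun i => by
      rw [hB, of_apply, conj_mul_exp_I]
      simp only [map_mul, map_sub, conj_I, conj_conj, apply_ite (starRingEnd ℂ), map_one, map_zero,
        a]
      split_ifs <;> ring
    simp only [mulVec, dotProduct, conjTranspose_apply, RCLike.star_def, hcol]
    rw [← Finset.mul_sum, Finset.sum_sub_distrib, ← Finset.mul_sum, ← Finset.mul_sum]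
    simp
  have hBnorm : ∀ (x : Fin N → ℂ) j, normSq ((Bᴴ *ᵥ x) j) =
      normSq ((starRingEnd ℂ) (a α0 j * f (v j)) * x (u j) -
        a α0 j * (starRingEnd ℂ) (f (u j)) * x (v j)) := fun x j => by
    rw [hBx, normSq_mul, normSq_neg, normSq_I, one_mul]
  have hP' : P = Matrix.diagonal fun j => (((if w j = 0 then 1 else 0 : ℝ)) : ℂ) := by
    rw [hP, hΩ', nullProj_diagonal]
    congr 1
    ext j
    split_ifs <;> simp
  have hVker : ∀ y j, w j = 0 → (Bᴴ *ᵥ (V *ᵥ y)) j = 0 := fun y j hj => by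
    have hmem : V *ᵥ y ∈ LinearMap.ker (B * P * Bᴴ).mulVecLin := by
      rw [← hVrange]
      exact ⟨y, rfl⟩
    rw [LinearMap.mem_ker, mulVecLin_apply, hP'] at hmem
    have h0 := re_star_dotProduct_mul_diagonal_mul (fun j => if w j = 0 then 1 else 0) B (V *ᵥ y)
    rw [hmem, dotProduct_zero, zero_re, eq_comm, Finset.sum_eq_zero_iff_of_nonneg] at h0
    · simpa [hj] using h0 j (Finset.mem_univ j)
    · intro i _
      split_ifs <;> simp [normSq_nonneg]
  have hdim : m + iinf = N := by
    have hinj : Function.Injective V.mulVecLin := fun y z hyz => by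
      simpa [mulVec_mulVec, hV] using congrArg (Vᴴ *ᵥ ·) hyz
    have h1 := LinearMap.finrank_range_add_finrank_ker (B * P * Bᴴ).mulVecLin
    rw [← hVrange, LinearMap.finrank_range_of_inj hinj] at h1
    simp only [Module.finrank_fin_fun] at h1
    rw [hiinf, Matrix.rank]
    omega
  have hpinv : pinvH Ω = Matrix.diagonal fun j => (((w j)⁻¹ : ℝ) : ℂ) := by
    rw [hΩ', pinvH_diagonal]
    simp
  have hSherm : S.IsHermitian := by
    rw [hS]
    refine isHermitian_conjTranspose_mul_mul _ (((hTherm α0).sub ?_).sub ?_)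
    · simp [IsHermitian, conjTranspose_smul]
    · rw [hpinv]
      exact isHermitian_mul_mul_conjTranspose _ (isHermitian_diagonal_ofReal _)
  have hSquad : ∀ y, (star y ⬝ᵥ S *ᵥ y).re = (star (V *ᵥ y) ⬝ᵥ T α0 *ᵥ (V *ᵥ y)).re -
      lam * (star y ⬝ᵥ y).re - ∑ j, (w j)⁻¹ * normSq ((Bᴴ *ᵥ (V *ᵥ y)) j) := fun y => by
    have hnorm : star (V *ᵥ y) ⬝ᵥ (V *ᵥ y) = star y ⬝ᵥ y := by
      rw [star_mulVec, ← dotProduct_mulVec, mulVec_mulVec, hV, one_mulVec]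
    have h1 : star y ⬝ᵥ S *ᵥ y = star (V *ᵥ y) ⬝ᵥ (T α0 - (lam : ℂ) •
        (1 : Matrix (Fin N) (Fin N) ℂ) - B * pinvH Ω * Bᴴ) *ᵥ (V *ᵥ y) := by
      rw [hS, star_mulVec, ← dotProduct_mulVec, mulVec_mulVec, mulVec_mulVec, Matrix.mul_assoc]
    rw [h1, sub_mulVec, sub_mulVec, dotProduct_sub, dotProduct_sub, sub_re, sub_re, hpinv,
      re_star_dotProduct_mul_diagonal_mul, smul_mulVec, one_mulVec, dotProduct_smul, hnorm,
      smul_eq_mul, re_ofReal_mul]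
  let c : Fin d → ((Fin m → ℂ) →ₗ[ℂ] ℂ) := fun j =>
    ((starRingEnd ℂ) (a α0 j * f (v j)) • (LinearMap.proj (u j) : (Fin N → ℂ) →ₗ[ℂ] ℂ) -
      (a α j * (starRingEnd ℂ) (f (u j))) • LinearMap.proj (v j)).comp V.mulVecLin
  have hdiff : ∀ y, (star (V *ᵥ y) ⬝ᵥ T α *ᵥ (V *ᵥ y)).re =
      (star y ⬝ᵥ S *ᵥ y).re + lam * (star y ⬝ᵥ y).re + ∑ j, (w j)⁻¹ * normSq (c j y) := fun y => by
    rw [hSquad, hquad, hquad]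
    suffices hsum : ∀ j, 2 * (a α j * (V *ᵥ y) (v j) * (starRingEnd ℂ) ((V *ᵥ y) (u j))).re =
        2 * (a α0 j * (V *ᵥ y) (v j) * (starRingEnd ℂ) ((V *ᵥ y) (u j))).re -
          (w j)⁻¹ * normSq ((Bᴴ *ᵥ (V *ᵥ y)) j) + (w j)⁻¹ * normSq (c j y) by
      simp only [hsum, Finset.sum_add_distrib, Finset.sum_sub_distrib]
      ring
    intro j
    have ha0 : a α0 j ≠ 0 := mul_ne_zero (hh j) (Complex.exp_ne_zero _)
    by_cases hw : w j = 0
    · have hz : a α0 j * f (v j) * (starRingEnd ℂ) (f (u j)) = 0 :=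
        Complex.ext (neg_eq_zero.1 hw) (hcrit j)
      have hb := hVker y j hw
      rw [hBx] at hb
      have hx : (V *ᵥ y) (u j) = 0 ∨ (V *ᵥ y) (v j) = 0 := by
        rcases mul_eq_zero.1 hz with hfv | hfu
        · have hfv' := (mul_eq_zero.1 hfv).resolve_left ha0
          have hfu := (hnv j).resolve_right (not_not.2 hfv')
          right
          simpa [hfv', ha0, hfu] using hb
        · have hfu' : f (u j) = 0 := by simpa using hfu
          have hfv := (hnv j).resolve_left (not_not.2 hfu')
          left
          simpa [hfu', ha0, hfv] using hb
      rcases hx with hx | hx <;> simp [hx, hw]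
    · have key := edge_form_difference (a α0 j) (a α j) (f (u j)) (f (v j)) ((V *ᵥ y) (u j))
        ((V *ᵥ y) (v j)) (by rw [hnormSq, hnormSq]) (hcrit j)
      rw [← hBnorm] at key
      have hc : c j y = (starRingEnd ℂ) (a α0 j * f (v j)) * (V *ᵥ y) (u j) -
          a α j * (starRingEnd ℂ) (f (u j)) * (V *ᵥ y) (v j) := rfl
      rw [← hc] at key
      change _ = w j * _ at key
      have key' := congrArg ((w j)⁻¹ * ·) key
      simp only [inv_mul_cancel_left₀ hw, mul_sub (w j)⁻¹] at key'
      linarith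
  constructor
  · rw [heS]
    split_ifs with hk hk'
    · rw [EReal.coe_le_coe_iff, le_sub_iff_add_le]
      refine le_sortedEigs_of_compression (hTherm α) hSherm hV
        (fun j : {j // w j < 0} => c j) lam (fun y hy => ?_) n _ ?_
      · rw [hdiff]
        refine le_add_of_nonneg_right (Finset.sum_nonneg fun j _ => ?_)
        rcases lt_or_ge (w j) 0 with hj | hj
        · simp [hy ⟨j, hj⟩]
        · exact mul_nonneg (inv_nonneg.2 hj) (normSq_nonneg _)
      · have hcard : iNeg Ω = _ := hΩ' ▸ iNeg_diagonal w
        simp only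
        omega
    · exact bot_le
    · have := n.2
      omega
  · rw [heS]
    split_ifs with hk hk'
    · rw [EReal.coe_le_coe_iff, sub_le_iff_le_add]
      refine sortedEigs_le_of_compression (hTherm α) hSherm hV
        (fun j : {j // 0 < w j} => c j) lam (fun y hy => ?_) n _ ?_
      · rw [hdiff]
        refine add_le_of_nonpos_right (Finset.sum_nonpos fun j _ => ?_)
        rcases lt_or_ge 0 (w j) with hj | hj
        · simp [hy ⟨j, hj⟩]
        · exact mul_nonpos_of_nonpos_of_nonneg (inv_nonpos.2 hj) (normSq_nonneg _)
      · have hcard : iPos Ω = _ := hΩ' ▸ iPos_diagonal w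
        simp only
        omega
    · omega
    · exact le_top
end
end
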